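/- Let S be a Noetherian ring, R = S/I, and let N, N' be finitely generated R-modules. Let L be an S-free resolution of N, G an R-free resolution of N, and φ: L → G a map of complexes extending the identity of N. If m is the depth of ann(N) on N', then the induced map H^m(Hom_R(G, N')) → H^m(Hom_S(L, N')) is an isomorphism; in particular the comparison map φ induces the standard isomorphism Ext^m_R(N, N') ≅ Ext^m_S(N, N'). -/

import Mathlib

namespace CompAux

def Cob {A : Type*} [CommRing A] {K : ℕ → Type*} [∀ i, AddCommGroup (K i)] [∀ i, Module A (K i)]
    (d : ∀ i : ℕ, K (i + 1) →ₗ[A] K i) {M : Type*} [AddCommGroup M] [Module A M] :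
    ∀ i : ℕ, (K i →ₗ[A] M) → Prop
  | 0, θ => θ = 0
  | (j + 1), θ => ∃ χ : K j →ₗ[A] M, θ = χ ∘ₗ d j

lemma lift_range {A P M M' : Type*} [CommRing A] [AddCommGroup P] [Module A P]
    [Module.Projective A P] [AddCommGroup M] [Module A M] [AddCommGroup M'] [Module A M']
    (g : M →ₗ[A] M') (f : P →ₗ[A] M') (h : ∀ p, ∃ y, g y = f p) :
    ∃ f' : P →ₗ[A] M, g ∘ₗ f' = f := by
  obtain ⟨f', hf'⟩ := Module.projective_lifting_property g.rangeRestrict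
    (f.codRestrict (LinearMap.range g) (fun p => h p)) g.surjective_rangeRestrict
  refine ⟨f', ?_⟩
  ext p
  have := congrArg Subtype.val (LinearMap.congr_fun hf' p)
  exact this

section
variable {A : Type*} [CommRing A] {K : ℕ → Type*} [∀ i, AddCommGroup (K i)]
  [∀ i, Module A (K i)] (d : ∀ i : ℕ, K (i + 1) →ₗ[A] K i)

lemma Cob.sub {M : Type*} [AddCommGroup M] [Module A M] {i : ℕ} {f g : K i →ₗ[A] M}
    (hf : Cob d i f) (hg : Cob d i g) : Cob d i (f - g) := by
  cases i with
  | zero => simp only [Cob] at *; simp [hf, hg]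
  | succ j =>
    obtain ⟨a, rfl⟩ := hf
    obtain ⟨b, rfl⟩ := hg
    exact ⟨a - b, by rw [LinearMap.sub_comp]⟩

lemma Cob.comp {M M' : Type*} [AddCommGroup M] [Module A M] [AddCommGroup M'] [Module A M']
    {i : ℕ} {f : K i →ₗ[A] M}
    (hf : Cob d i f) (g : M →ₗ[A] M') : Cob d i (g ∘ₗ f) := by
  cases i with
  | zero => simp only [Cob] at *; simp [hf]
  | succ j =>
    obtain ⟨a, rfl⟩ := hf
    exact ⟨g ∘ₗ a, by rw [LinearMap.comp_assoc]⟩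

lemma Cob.cocycle (hd : ∀ i x, d i (d (i + 1) x) = 0)
    {M : Type*} [AddCommGroup M] [Module A M] {i : ℕ} {f : K i →ₗ[A] M}
    (hf : Cob d i f) (x) : f (d i x) = 0 := by
  cases i with
  | zero => simp only [Cob] at *; simp [hf]
  | succ j =>
    obtain ⟨a, rfl⟩ := hf
    simp [hd]

lemma Cob.lift [∀ i, Module.Projective A (K i)]
    {M M' : Type*} [AddCommGroup M] [Module A M] [AddCommGroup M'] [Module A M']
    (g : M →ₗ[A] M') (hg : Function.Surjective g) {i : ℕ} {f : K i →ₗ[A] M'}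
    (hf : Cob d i f) : ∃ f' : K i →ₗ[A] M, Cob d i f' ∧ g ∘ₗ f' = f := by
  cases i with
  | zero => simp only [Cob] at *; exact ⟨0, rfl, by simp [hf]⟩
  | succ j =>
    obtain ⟨a, rfl⟩ := hf
    obtain ⟨b, hb⟩ := Module.projective_lifting_property g a hg
    exact ⟨b ∘ₗ d j, ⟨b, rfl⟩, by rw [← LinearMap.comp_assoc, hb]⟩

variable [∀ i, Module.Projective A (K i)] {N : Type*} [AddCommGroup N] [Module A N]
  (ε : K 0 →ₗ[A] N)
  (h0 : LinearMap.ker ε = LinearMap.range (d 0))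
  (hex : ∀ i, LinearMap.ker (d i) = LinearMap.range (d (i + 1)))

include hex in
lemma dd (i : ℕ) (x) : d i (d (i + 1) x) = 0 := by
  have : d (i + 1) x ∈ LinearMap.ker (d i) := by rw [hex]; exact ⟨x, rfl⟩
  exact this

include h0 in
lemma hty_zero (a : A) (ha : ∀ n : N, a • n = 0) :
    ∃ s : K 0 →ₗ[A] K 1, ∀ x, d 0 (s x) = a • x := by
  obtain ⟨s, hs⟩ := lift_range (d 0) (a • LinearMap.id) (fun p => by
    have : a • p ∈ LinearMap.ker ε := by simp [ha]
    rw [h0] at this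
    exact this)
  exact ⟨s, fun x => by simpa using LinearMap.congr_fun hs x⟩

include h0 hex in
lemma hty (a : A) (ha : ∀ n : N, a • n = 0) (i : ℕ) :
    ∃ s : K i →ₗ[A] K (i + 1), ∀ x, d i (s (d i x)) = a • d i x := by
  induction i with
  | zero =>
    obtain ⟨s, hs⟩ := hty_zero d ε h0 a ha
    exact ⟨s, fun x => hs _⟩
  | succ i ih =>
    obtain ⟨s, hs⟩ := ih
    obtain ⟨t, ht⟩ := lift_range (d (i + 1)) (a • LinearMap.id - s ∘ₗ d i) (fun p => by
      have : (a • (LinearMap.id : K (i + 1) →ₗ[A] K (i + 1)) - s ∘ₗ d i) p ∈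
          LinearMap.ker (d i) := by simp [hs]
      rw [hex] at this
      exact this)
    refine ⟨t, fun x => ?_⟩
    have := LinearMap.congr_fun ht (d (i + 1) x)
    simpa [dd d hex] using this

include h0 hex in
lemma hty_cob (a : A) (ha : ∀ n : N, a • n = 0) (i : ℕ)
    {M : Type*} [AddCommGroup M] [Module A M] (θ : K i →ₗ[A] M)
    (hθ : ∀ x, θ (d i x) = 0) : Cob d i (a • θ) := by
  cases i with
  | zero =>
    obtain ⟨s, hs⟩ := hty_zero d ε h0 a ha
    show a • θ = 0
    ext x
    have := hθ (s x)
    simpa [hs] using this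
  | succ i =>
    obtain ⟨s, hs⟩ := hty d ε h0 hex a ha i
    obtain ⟨t, ht⟩ := lift_range (d (i + 1)) (a • LinearMap.id - s ∘ₗ d i) (fun p => by
      have : (a • (LinearMap.id : K (i + 1) →ₗ[A] K (i + 1)) - s ∘ₗ d i) p ∈
          LinearMap.ker (d i) := by simp [hs]
      rw [hex] at this
      exact this)
    refine ⟨θ ∘ₗ s, ?_⟩
    ext x
    have h1 := LinearMap.congr_fun ht x
    have h2 := hθ (t x)
    simp only [LinearMap.comp_apply] at h1
    rw [h1] at h2
    simpa [sub_eq_zero] using h2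

end

section
open scoped Pointwise
variable {A R : Type*} [CommRing A] [CommRing R] [Algebra A R]
  {M : Type*} [AddCommGroup M] [Module R M] [Module A M] [IsScalarTower A R M]

/-- the projection -/
def pr (A : Type*) {R : Type*} [CommRing A] [CommRing R] [Algebra A R]
  (M : Type*) [AddCommGroup M] [Module R M] [Module A M] [IsScalarTower A R M] (x : R) :
    M →ₗ[A] QuotSMulTop x M :=
  (Submodule.mkQ (x • (⊤ : Submodule R M))).restrictScalars A

lemma pr_surj (x : R) : Function.Surjective (pr A M x) := by
  intro y
  obtain ⟨z, hz⟩ := Submodule.mkQ_surjective (x • (⊤ : Submodule R M)) y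
  exact ⟨z, hz⟩

lemma pr_eq_zero (x : R) (y : M) : pr A M x y = 0 ↔ ∃ z, x • z = y := by
  show Submodule.Quotient.mk y = 0 ↔ _
  rw [Submodule.Quotient.mk_eq_zero, Submodule.mem_smul_pointwise_iff_exists]
  simp

lemma div_lift {P : Type*} [AddCommGroup P] [Module A P] [Module.Projective A P]
    (x : R) (f : P →ₗ[A] M) (h : ∀ p, pr A M x (f p) = 0) :
    ∃ g : P →ₗ[A] M, ∀ p, x • g p = f p := by
  obtain ⟨g, hg⟩ := lift_range ((LinearMap.lsmul R M x).restrictScalars A) f (fun p => by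
    simpa using (pr_eq_zero x (f p)).1 (h p))
  exact ⟨g, fun p => by simpa using LinearMap.congr_fun hg p⟩
end

lemma vanish {A R : Type*} [CommRing A] [CommRing R] [Algebra A R]
    (hAR : Function.Surjective (algebraMap A R))
    {K : ℕ → Type*} [∀ i, AddCommGroup (K i)]
    [∀ i, Module A (K i)] (d : ∀ i : ℕ, K (i + 1) →ₗ[A] K i)
    [∀ i, Module.Projective A (K i)] {N : Type*} [AddCommGroup N] [Module R N] [Module A N]
    [IsScalarTower A R N]
    (ε : K 0 →ₗ[A] N)
    (h0 : LinearMap.ker ε = LinearMap.range (d 0))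
    (hex : ∀ i, LinearMap.ker (d i) = LinearMap.range (d (i + 1)))
    (rs : List R) (hann : ∀ r ∈ rs, ∀ n : N, r • n = 0) :
    ∀ (M : Type*) [AddCommGroup M] [Module R M] [Module A M] [IsScalarTower A R M]
      (_ : RingTheory.Sequence.IsWeaklyRegular M rs)
      (i : ℕ) (_ : i < rs.length) (θ : K i →ₗ[A] M) (_ : ∀ x, θ (d i x) = 0), Cob d i θ := by
  induction rs with
  | nil => intro M _ _ _ _ _ i hi; simp at hi
  | cons x rs ih =>
    intro M _ _ _ _ hreg i hi θ hθ
    rw [RingTheory.Sequence.isWeaklyRegular_cons_iff] at hreg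
    obtain ⟨hx, hreg⟩ := hreg
    obtain ⟨a, rfl⟩ := hAR x
    have hc := hty_cob d ε h0 hex a
      (fun n => by rw [← algebraMap_smul R a n]; exact hann _ (by simp) n) i θ hθ
    cases i with
    | zero =>
      show θ = 0
      ext p
      apply hx
      have := LinearMap.congr_fun (show a • θ = 0 from hc) p
      simpa using this
    | succ i =>
      obtain ⟨χ, hχ⟩ := hc
      have h1 : Cob d i (pr A M (algebraMap A R a) ∘ₗ χ) := by
        refine ih (fun r hr => hann r (by simp [hr])) _ hreg i (by simpa using hi) _ ?_
        intro y
        rw [LinearMap.comp_apply, pr_eq_zero]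
        refine ⟨θ y, ?_⟩
        simpa using LinearMap.congr_fun hχ y
      obtain ⟨η, hη, hη'⟩ := h1.lift d _ (pr_surj _)
      obtain ⟨g, hg⟩ := div_lift (algebraMap A R a) (χ - η) (fun p => by
        have := LinearMap.congr_fun hη' p
        simp only [LinearMap.comp_apply] at this
        simp [this])
      refine ⟨g, ?_⟩
      ext p
      apply hx
      have h2 := LinearMap.congr_fun hχ p
      have h3 := hg (d i p)
      have h4 := hη.cocycle d (dd d hex) p
      simp only [LinearMap.sub_apply, h4, sub_zero] at h3
      simp only [LinearMap.comp_apply, LinearMap.smul_apply] at h2 ⊢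
      rw [h3, ← h2, algebraMap_smul]

lemma compare {A R : Type*} [CommRing A] [CommRing R] [Algebra A R]
    (hAR : Function.Surjective (algebraMap A R))
    {N : Type*} [AddCommGroup N] [Module R N] [Module A N] [IsScalarTower A R N]
    {L : ℕ → Type*} [∀ i, AddCommGroup (L i)] [∀ i, Module A (L i)]
    [∀ i, Module.Projective A (L i)] (dL : ∀ i : ℕ, L (i + 1) →ₗ[A] L i)
    (εL : L 0 →ₗ[A] N) (hεL : Function.Surjective εL)
    (hL0 : LinearMap.ker εL = LinearMap.range (dL 0))
    (hL : ∀ i, LinearMap.ker (dL i) = LinearMap.range (dL (i + 1)))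
    {G : ℕ → Type*} [∀ i, AddCommGroup (G i)] [∀ i, Module R (G i)]
    [∀ i, Module A (G i)] [∀ i, IsScalarTower A R (G i)]
    [∀ i, Module.Projective R (G i)] (dG : ∀ i : ℕ, G (i + 1) →ₗ[R] G i)
    (εG : G 0 →ₗ[R] N)
    (hG0 : LinearMap.ker εG = LinearMap.range (dG 0))
    (hG : ∀ i, LinearMap.ker (dG i) = LinearMap.range (dG (i + 1)))
    (φ : ∀ i : ℕ, L i →ₗ[A] G i)
    (hφ : ∀ i x, φ i (dL i x) = dG i (φ (i + 1) x))
    (hφε : ∀ x, εG (φ 0 x) = εL x)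
    (rs : List R) (hann : ∀ r ∈ rs, ∀ n : N, r • n = 0) :
    ∀ (M : Type*) [AddCommGroup M] [Module R M] [Module A M] [IsScalarTower A R M]
      (_ : RingTheory.Sequence.IsWeaklyRegular M rs),
      (∀ ψ : G rs.length →ₗ[R] M, (∀ x, ψ (dG _ x) = 0) →
        Cob dL _ ((ψ.restrictScalars A) ∘ₗ φ rs.length) → Cob dG _ ψ) ∧
      (∀ θ : L rs.length →ₗ[A] M, (∀ x, θ (dL _ x) = 0) →
        ∃ ψ : G rs.length →ₗ[R] M, (∀ x, ψ (dG _ x) = 0) ∧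
        Cob dL _ ((ψ.restrictScalars A) ∘ₗ φ rs.length - θ)) := by
  induction rs with
  | nil =>
    intro M _ _ _ _ _
    refine ⟨fun ψ hψ hc => ?_, fun θ hθ => ?_⟩
    · show ψ = 0
      ext g
      obtain ⟨l, hl⟩ := hεL (εG g)
      have h1 : g - φ 0 l ∈ LinearMap.ker εG := by simp [hφε, hl]
      rw [hG0] at h1
      obtain ⟨y, hy⟩ := h1
      have h2 := hψ y
      have h3 := LinearMap.congr_fun
        (show (ψ.restrictScalars A) ∘ₗ φ 0 = 0 from hc) l
      simp only [LinearMap.comp_apply, LinearMap.restrictScalars_apply,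
        LinearMap.zero_apply] at h3
      have h4 : ψ (dG 0 y) = ψ (g - φ 0 l) := congrArg ψ hy
      rw [map_sub, h3, sub_zero] at h4
      rw [← h4]
      exact h2
    · have hk : LinearMap.ker εL ≤ LinearMap.ker θ := by
        rw [hL0]
        rintro _ ⟨y, rfl⟩
        exact hθ y
      let τ : N →ₗ[A] M := (LinearMap.ker εL).liftQ θ hk ∘ₗ
        (εL.quotKerEquivOfSurjective hεL).symm.toLinearMap
      have hτ : ∀ l, τ (εL l) = θ l := by
        intro l
        have : (εL.quotKerEquivOfSurjective hεL).symm (εL l) = Submodule.Quotient.mk l := by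
          rw [LinearEquiv.symm_apply_eq]; rfl
        show (LinearMap.ker εL).liftQ θ hk ((εL.quotKerEquivOfSurjective hεL).symm (εL l)) = _
        rw [this]; rfl
      let τ' : N →ₗ[R] M :=
        { toFun := τ
          map_add' := τ.map_add
          map_smul' := fun r n => by
            obtain ⟨a, rfl⟩ := hAR r
            simp }
      refine ⟨τ' ∘ₗ εG, fun y => ?_, ?_⟩
      · have : dG 0 y ∈ LinearMap.ker εG := by rw [hG0]; exact ⟨y, rfl⟩
        have h : εG (dG 0 y) = 0 := this
        show τ' (εG (dG 0 y)) = 0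
        rw [h, map_zero]
      · show _ = _
        ext l
        have : τ (εG (φ 0 l)) = θ l := by rw [hφε, hτ]
        show τ (εG (φ 0 l)) - θ l = 0
        rw [this, sub_self]
  | cons x rs ih =>
    intro M _ _ _ _ hreg0
    have hreg := hreg0
    rw [RingTheory.Sequence.isWeaklyRegular_cons_iff] at hreg
    obtain ⟨hx, hreg⟩ := hreg
    have ih' := ih (fun r hr => hann r (by simp [hr])) _ hreg
    obtain ⟨ihI, ihS⟩ := ih'
    have hxn : ∀ n : N, x • n = 0 := hann x (by simp)
    obtain ⟨a, hax⟩ := hAR x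
    have hsm : ∀ z : M, a • z = x • z := fun z => by rw [← hax, algebraMap_smul]
    have han : ∀ n : N, a • n = 0 := fun n => by
      rw [← algebraMap_smul R a n, hax]; exact hxn n
    have hv := vanish hAR dL εL hL0 hL (x :: rs) hann M hreg0
    change (∀ ψ : G (rs.length + 1) →ₗ[R] M, (∀ y, ψ (dG (rs.length + 1) y) = 0) →
        Cob dL (rs.length + 1) ((ψ.restrictScalars A) ∘ₗ φ (rs.length + 1)) →
          Cob dG (rs.length + 1) ψ) ∧
      (∀ θ : L (rs.length + 1) →ₗ[A] M, (∀ y, θ (dL (rs.length + 1) y) = 0) →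
        ∃ ψ : G (rs.length + 1) →ₗ[R] M, (∀ y, ψ (dG (rs.length + 1) y) = 0) ∧
        Cob dL (rs.length + 1) ((ψ.restrictScalars A) ∘ₗ φ (rs.length + 1) - θ))
    have hlt : rs.length < (x :: rs).length := by simp
    generalize rs.length = k at *
    refine ⟨fun ψ hψ hc => ?_, fun θ hθ => ?_⟩
    · obtain ⟨χ', hχ'⟩ := hc
      obtain ⟨χ, hχ⟩ := hty_cob dG εG hG0 hG x hxn (k + 1) ψ hψ
      have e1 : ∀ y, x • ψ y = χ (dG k y) := fun y => LinearMap.congr_fun hχ y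
      have e2 : ∀ y, ψ (φ (k + 1) y) = χ' (dL k y) := fun y => LinearMap.congr_fun hχ' y
      have c1 := hv k hlt (χ.restrictScalars A ∘ₗ φ k - a • χ') (fun y => by
        show χ (φ k (dL k y)) - a • χ' (dL k y) = 0
        rw [hφ, ← e1, ← e2, hsm, sub_self])
      have c2 := c1.comp dL (pr A M x)
      have c3 := ihI ((pr R M x) ∘ₗ χ) (fun y => by
        rw [LinearMap.comp_apply, pr_eq_zero]
        exact ⟨ψ y, e1 y⟩) (by
        convert c2 using 1
        ext y
        show pr A M x (χ (φ k y)) = pr A M x (χ (φ k y) - a • χ' y)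
        rw [map_sub, (pr_eq_zero x (a • χ' y)).2 ⟨χ' y, (hsm _).symm⟩, sub_zero])
      obtain ⟨η, hη, hη'⟩ := c3.lift dG _ (pr_surj _)
      obtain ⟨g, hg⟩ := div_lift x (χ - η) (fun p => by
        have := LinearMap.congr_fun hη' p
        simp only [LinearMap.comp_apply] at this
        simp [this])
      refine ⟨g, ?_⟩
      ext p
      apply hx
      have h3 := hg (dG k p)
      have h4 := hη.cocycle dG (dd dG hG) p
      simp only [LinearMap.sub_apply, h4, sub_zero] at h3
      show x • ψ p = x • g (dG k p)
      rw [h3, e1]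
    · obtain ⟨χ', hχ'⟩ := hty_cob dL εL hL0 hL a han (k + 1) θ hθ
      have e1 : ∀ y, a • θ y = χ' (dL k y) := fun y => LinearMap.congr_fun hχ' y
      obtain ⟨ψ', hψ', c⟩ := ihS (pr A M x ∘ₗ χ') (fun y => by
        rw [LinearMap.comp_apply, pr_eq_zero]
        exact ⟨θ y, by rw [← hsm, e1]⟩)
      obtain ⟨ξ, hξ⟩ := Module.projective_lifting_property (pr R M x) ψ' (pr_surj _)
      have e2 : ∀ y, pr R M x (ξ y) = ψ' y := fun y => LinearMap.congr_fun hξ y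
      obtain ⟨ψ, e3⟩ := div_lift x (ξ ∘ₗ dG k) (fun p => by
        rw [LinearMap.comp_apply, e2, hψ'])
      refine ⟨ψ, fun y => hx ?_, ?_⟩
      · show x • _ = x • 0
        rw [e3, LinearMap.comp_apply, dd dG hG, map_zero, smul_zero]
      · obtain ⟨η, hη, hη'⟩ := c.lift dL (pr A M x) (pr_surj _)
        obtain ⟨ζ, hζ⟩ := div_lift x (ξ.restrictScalars A ∘ₗ φ k - χ' - η) (fun p => by
          have h : pr A M x (η p) = ψ' (φ k p) - pr A M x (χ' p) :=
            LinearMap.congr_fun hη' p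
          show pr A M x (ξ (φ k p) - χ' p - η p) = 0
          have h' : pr A M x (ξ (φ k p)) = ψ' (φ k p) := e2 _
          rw [map_sub, map_sub, h, h', sub_self])
        refine ⟨ζ, ?_⟩
        ext p
        apply hx
        show x • (ψ (φ (k + 1) p) - θ p) = x • ζ (dL k p)
        rw [hζ, smul_sub, e3, ← hsm, e1]
        show _ = ξ (φ k (dL k p)) - χ' (dL k p) - η (dL k p)
        rw [hη.cocycle dL (dd dL hL), sub_zero, hφ]
        rfl

end CompAux


/-!
STATEMENT 7 (comparison lemma): `S` Noetherian, `R = S/I`, `N, N'` finitely generated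
`R`-modules, `L` an `S`-free resolution of `N`, `G` an `R`-free resolution of `N`,
`φ : L → G` a chain map extending `id_N`, and `m` the depth of `ann N` on `N'`.
Then precomposition with `φ` induces an isomorphism
`H^m(Hom_R(G, N')) ≅ H^m(Hom_S(L, N'))` (i.e. `Ext^m_R(N,N') ≅ Ext^m_S(N,N')`),
stated here elementwise on cocycles modulo coboundaries.
-/

theorem comparison_Hm_iso
    (S : Type*) [CommRing S] [IsNoetherianRing S] (I : Ideal S)
    (N N' : Type*)
    [AddCommGroup N] [Module (S ⧸ I) N] [Module S N] [IsScalarTower S (S ⧸ I) N]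
    [AddCommGroup N'] [Module (S ⧸ I) N'] [Module S N'] [IsScalarTower S (S ⧸ I) N']
    [Module.Finite (S ⧸ I) N] [Module.Finite (S ⧸ I) N']
    -- `m` is the depth of `ann N` on `N'`: there is a maximal `N'`-regular sequence of
    -- length `m` in the annihilator of `N`
    (m : ℕ) (rs : List (S ⧸ I)) (hlen : rs.length = m)
    (hrs_ann : ∀ r ∈ rs, r ∈ Module.annihilator (S ⧸ I) N)
    (hrs_reg : RingTheory.Sequence.IsRegular N' rs)
    (hrs_max : ∀ r ∈ Module.annihilator (S ⧸ I) N,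
      ∃ y : N' ⧸ (Ideal.ofList rs • (⊤ : Submodule (S ⧸ I) N')), y ≠ 0 ∧ r • y = 0)
    -- an `S`-free resolution `L` of `N`
    (L : ℕ → Type*) [∀ i, AddCommGroup (L i)] [∀ i, Module S (L i)]
    [∀ i, Module.Free S (L i)] [∀ i, Module.Finite S (L i)]
    (dL : ∀ i : ℕ, L (i + 1) →ₗ[S] L i)
    (εL : L 0 →ₗ[S] N) (hεLsurj : Function.Surjective εL)
    (hL0 : LinearMap.ker εL = LinearMap.range (dL 0))
    (hLexact : ∀ i, LinearMap.ker (dL i) = LinearMap.range (dL (i + 1)))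
    -- an `R`-free resolution `G` of `N`
    (G : ℕ → Type*) [∀ i, AddCommGroup (G i)] [∀ i, Module (S ⧸ I) (G i)]
    [∀ i, Module S (G i)] [∀ i, IsScalarTower S (S ⧸ I) (G i)]
    [∀ i, Module.Free (S ⧸ I) (G i)] [∀ i, Module.Finite (S ⧸ I) (G i)]
    (dG : ∀ i : ℕ, G (i + 1) →ₗ[S ⧸ I] G i)
    (εG : G 0 →ₗ[S ⧸ I] N) (hεGsurj : Function.Surjective εG)
    (hG0 : LinearMap.ker εG = LinearMap.range (dG 0))
    (hGexact : ∀ i, LinearMap.ker (dG i) = LinearMap.range (dG (i + 1)))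
    -- `φ : L → G`, a map of complexes extending the identity of `N`
    (φ : ∀ i : ℕ, L i →ₗ[S] G i)
    (hφchain : ∀ i, (φ i) ∘ₗ (dL i) = ((dG i).restrictScalars S) ∘ₗ (φ (i + 1)))
    (hφaug : (εG.restrictScalars S) ∘ₗ (φ 0) = εL) :
    -- `ψ ↦ ψ ∘ φₘ` sends cocycles to cocycles and coboundaries to coboundaries, and
    -- induces a bijection `H^m(Hom_R(G,N')) → H^m(Hom_S(L,N'))`
    (∀ ψ : G m →ₗ[S ⧸ I] N', ψ ∘ₗ (dG m) = 0 →
      ((ψ.restrictScalars S) ∘ₗ (φ m)) ∘ₗ (dL m) = 0) ∧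
    (∀ ψ : G m →ₗ[S ⧸ I] N',
      (∃ (j : ℕ) (h : j + 1 = m) (χ : G j →ₗ[S ⧸ I] N'), ψ = h ▸ (χ ∘ₗ (dG j))) →
      ∃ (j : ℕ) (h : j + 1 = m) (χ' : L j →ₗ[S] N'),
        (ψ.restrictScalars S) ∘ₗ (φ m) = h ▸ (χ' ∘ₗ (dL j))) ∧
    -- injectivity on `H^m`
    (∀ ψ : G m →ₗ[S ⧸ I] N', ψ ∘ₗ (dG m) = 0 →
      (∃ (j : ℕ) (h : j + 1 = m) (χ' : L j →ₗ[S] N'),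
        (ψ.restrictScalars S) ∘ₗ (φ m) = h ▸ (χ' ∘ₗ (dL j))) →
      ∃ (j : ℕ) (h : j + 1 = m) (χ : G j →ₗ[S ⧸ I] N'), ψ = h ▸ (χ ∘ₗ (dG j))) ∧
    -- surjectivity on `H^m`
    (∀ θ : L m →ₗ[S] N', θ ∘ₗ (dL m) = 0 →
      ∃ ψ : G m →ₗ[S ⧸ I] N', ψ ∘ₗ (dG m) = 0 ∧
        ((ψ.restrictScalars S) ∘ₗ (φ m) = θ ∨
          ∃ (j : ℕ) (h : j + 1 = m) (χ' : L j →ₗ[S] N'),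
            (ψ.restrictScalars S) ∘ₗ (φ m) - θ = h ▸ (χ' ∘ₗ (dL j)))) := by
  have hAR : Function.Surjective (algebraMap S (S ⧸ I)) := Ideal.Quotient.mk_surjective
  have hφ : ∀ i x, φ i (dL i x) = dG i (φ (i + 1) x) :=
    fun i x => LinearMap.congr_fun (hφchain i) x
  have key := CompAux.compare hAR dL εL hεLsurj hL0 hLexact dG εG hG0 hGexact φ hφ
    (fun x => LinearMap.congr_fun hφaug x) rs
    (fun r hr n => Module.mem_annihilator.1 (hrs_ann r hr) n) N' hrs_reg.toIsWeaklyRegular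
  rw [hlen] at key
  obtain ⟨kI, kS⟩ := key
  clear hlen
  refine ⟨fun ψ hψ => ?_, ?_, fun ψ hψ => ?_, fun θ hθ => ?_⟩
  · ext x
    show ψ (φ m (dL m x)) = 0
    rw [hφ]
    exact LinearMap.congr_fun hψ _
  · rintro ψ ⟨j, rfl, χ, rfl⟩
    refine ⟨j, rfl, χ.restrictScalars S ∘ₗ φ j, ?_⟩
    ext x
    show χ (dG j (φ (j + 1) x)) = χ (φ j (dL j x))
    rw [hφ]
  · rintro ⟨j, rfl, χ', h⟩
    obtain ⟨χ, hχ⟩ := kI ψ (fun x => LinearMap.congr_fun hψ x) ⟨χ', h⟩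
    exact ⟨j, rfl, χ, hχ⟩
  · obtain ⟨ψ, hψ, c⟩ := kS θ (fun x => LinearMap.congr_fun hθ x)
    refine ⟨ψ, LinearMap.ext hψ, ?_⟩
    cases m with
    | zero => exact Or.inl (sub_eq_zero.1 c)
    | succ j =>
      obtain ⟨χ', h⟩ := c
      exact Or.inr ⟨j, rfl, χ', h⟩
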